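/- Let R̂ be a Hecke R-matrix for the parameter q (R̂² = I + (q−q^{−1})R̂) and assume m_q ≠ 0 for 1 ≤ m ≤ k. Then the q-antisymmetrizer A^{(k)} and the q-symmetrizer S^{(k)} are projectors: (A^{(k)})² = A^{(k)} and (S^{(k)})² = S^{(k)}, as operators on V^{⊗k}. -/

import Mathlib

/-! Common definitions for quantum matrix algebras `M(R̂,F̂)` in the sense of
Isaev–Ogievetsky–Pyatov, "On quantum matrix algebras satisfying the
Cayley-Hamilton-Newton identities".

We model operators on `V^{⊗m}` (where `dim V = N`) as matrices indexed by
multi-indices `Fin m → Fin N`; entries are taken in a (possibly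
noncommutative) unital associative algebra `A` over a field `K`.
Sites (tensor factors) are numbered starting from `0`, so the paper's
`X_i` is `site m (i-1) X`, and the paper's `M_{\overline{k}}` is
`Mbar m F F⁻¹ M (k-1)`. -/

namespace CHN

noncomputable section

/-- Operators on `V^{⊗m}` (`dim V = N`) with entries in a ring `A`. -/
abbrev Op (N : ℕ) (A : Type*) [Ring A] (m : ℕ) :=
  Matrix (Fin m → Fin N) (Fin m → Fin N) A

/-- Operators on `V ⊗ V`. -/
abbrev M2 (N : ℕ) (A : Type*) [Ring A] :=
  Matrix (Fin N × Fin N) (Fin N × Fin N) A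

/-- `site m i X` places the two-site operator `X` at the (0-based) tensor
factors `i, i+1` of `V^{⊗m}`, acting as the identity elsewhere.  In the
paper's 1-based notation, `X_i = site m (i-1) X`.  (Out of range it is the
identity.) -/
def site {A : Type*} [Ring A] {N : ℕ} (m i : ℕ) (X : M2 N A) : Op N A m :=
  fun a b =>
    if h : i + 1 < m then
      X (a ⟨i, Nat.lt_of_succ_lt h⟩, a ⟨i + 1, h⟩)
          (b ⟨i, Nat.lt_of_succ_lt h⟩, b ⟨i + 1, h⟩) *
        (if ∀ j : Fin m, (j : ℕ) ≠ i → (j : ℕ) ≠ i + 1 → a j = b j then 1 else 0)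
    else if a = b then 1 else 0

/-- `site1 m i X` places the one-site operator `X` at the (0-based) factor `i`. -/
def site1 {A : Type*} [Ring A] {N : ℕ} (m i : ℕ) (X : Matrix (Fin N) (Fin N) A) :
    Op N A m :=
  fun a b =>
    if h : i < m then
      X (a ⟨i, h⟩) (b ⟨i, h⟩) *
        (if ∀ j : Fin m, (j : ℕ) ≠ i → a j = b j then 1 else 0)
    else if a = b then 1 else 0

/-- `chain m X i l = X_i X_{i+1} ⋯ X_{i+l-1}` (0-based sites, `l` factors); in
the paper's 1-based notation this is `X_{i+1 → i+l}`. -/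
def chain {A : Type*} [Ring A] {N : ℕ} (m : ℕ) (X : M2 N A) (i : ℕ) :
    ℕ → Op N A m
  | 0 => 1
  | l + 1 => chain m X i l * site m (i + l) X

/-- The Yang–Baxter equation `X₁X₂X₁ = X₂X₁X₂` on `V^{⊗3}`. -/
def YB {A : Type*} [Ring A] {N : ℕ} (X : M2 N A) : Prop :=
  site 3 0 X * site 3 1 X * site 3 0 X = site 3 1 X * site 3 0 X * site 3 1 X

/-- Compatibility of a pair of R-matrices: both Yang–Baxter equations together
with the conditions `R̂₁F̂₂F̂₁ = F̂₂F̂₁R̂₂` and `F̂₁F̂₂R̂₁ = R̂₂F̂₁F̂₂` on `V^{⊗3}`. -/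
def Compatible {A : Type*} [Ring A] {N : ℕ} (R F : M2 N A) : Prop :=
  YB R ∧ YB F ∧
    site 3 0 R * site 3 1 F * site 3 0 F = site 3 1 F * site 3 0 F * site 3 1 R ∧
    site 3 0 F * site 3 1 F * site 3 0 R = site 3 1 R * site 3 0 F * site 3 1 F

/-- `Ψ` witnesses closedness of `F̂`:  `Ψ^{af}_{cg} F̂^{gb}_{fd} = δ^a_d δ^b_c`. -/
def IsClosedPair {A : Type*} [Ring A] {N : ℕ} (F Ψ : M2 N A) : Prop :=
  ∀ a b c d : Fin N,
    (∑ f : Fin N, ∑ g : Fin N, Ψ (a, f) (c, g) * F (g, b) (f, d)) =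
      if a = d ∧ b = c then 1 else 0

/-- The matrix `D`, `D^a_b := Ψ^{ac}_{bc}`. -/
def Dmat {A : Type*} [Ring A] {N : ℕ} (Ψ : M2 N A) : Matrix (Fin N) (Fin N) A :=
  fun a b => ∑ c : Fin N, Ψ (a, c) (b, c)

/-- Quantum trace (with weight `D`) over the last tensor factor. -/
def qtr1 {K : Type*} [Field K] {A : Type*} [Ring A] [Algebra K A] {N m : ℕ}
    (D : Matrix (Fin N) (Fin N) K) (X : Op N A (m + 1)) : Op N A m :=
  fun a b => ∑ c : Fin N, ∑ e : Fin N,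
    algebraMap K A (D c e) * X (Fin.snoc a e) (Fin.snoc b c)

/-- Quantum trace over the last `j` tensor factors. -/
def qtrs {K : Type*} [Field K] {A : Type*} [Ring A] [Algebra K A] {N : ℕ}
    (D : Matrix (Fin N) (Fin N) K) (m : ℕ) :
    (j : ℕ) → Op N A (m + j) → Op N A m
  | 0, X => X
  | j + 1, X => qtrs D m j (qtr1 D X)

/-- Full quantum trace `Tr_F(1,…,m)`, with values in `A`. -/
def qtrAll {K : Type*} [Field K] {A : Type*} [Ring A] [Algebra K A] {N m : ℕ}
    (D : Matrix (Fin N) (Fin N) K) (X : Op N A m) : A :=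
  ∑ a : Fin m → Fin N, ∑ b : Fin m → Fin N,
    algebraMap K A (∏ i, D (a i) (b i)) * X b a

/-- Quantum trace of a one-site operator:  `Tr_F X = Tr (D X)`. -/
def trF {K : Type*} [Field K] {A : Type*} [Ring A] [Algebra K A] {N : ℕ}
    (D : Matrix (Fin N) (Fin N) K) (X : Matrix (Fin N) (Fin N) A) : A :=
  ∑ a : Fin N, ∑ b : Fin N, algebraMap K A (D a b) * X b a

/-- Ordinary partial trace over the last tensor factor. -/
def ptr1 {A : Type*} [Ring A] {N m : ℕ} (X : Op N A (m + 1)) : Op N A m :=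
  fun a b => ∑ c : Fin N, X (Fin.snoc a c) (Fin.snoc b c)

/-- Ordinary partial trace over the last `j` tensor factors. -/
def ptrs {A : Type*} [Ring A] {N : ℕ} (m : ℕ) :
    (j : ℕ) → Op N A (m + j) → Op N A m
  | 0, X => X
  | j + 1, X => ptrs m j (ptr1 X)

/-- `Mbar m F Finv M k` is the paper's `M_{\overline{k+1}}` (0-based index `k`):
`M_{\overline{1}} := M₁` and `M_{\overline{k+1}} := F̂_k M_{\overline{k}} F̂_k⁻¹`. -/
def Mbar {A : Type*} [Ring A] {N : ℕ} (m : ℕ) (F Finv : M2 N A)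
    (M : Matrix (Fin N) (Fin N) A) : ℕ → Op N A m
  | 0 => site1 m 0 M
  | k + 1 => site m k F * Mbar m F Finv M k * site m k Finv

/-- `MbarSeg m F Finv M i l = M_{\overline{i+1}} M_{\overline{i+2}} ⋯ M_{\overline{i+l}}`,
the ordered product of `l` consecutive copies starting at 0-based index `i`.
In particular `MbarSeg m F Finv M 0 k = M_{\overline{1}} ⋯ M_{\overline{k}}`. -/
def MbarSeg {A : Type*} [Ring A] {N : ℕ} (m : ℕ) (F Finv : M2 N A)
    (M : Matrix (Fin N) (Fin N) A) (i : ℕ) : ℕ → Op N A m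
  | 0 => 1
  | l + 1 => MbarSeg m F Finv M i l * Mbar m F Finv M (i + l)

/-- The double twist `R̂^{FF} = F̂ (F̂ R̂ F̂⁻¹) F̂⁻¹`. -/
def RFF {K : Type*} [Field K] {N : ℕ} (R F : M2 N K) : M2 N K :=
  F * (F * R * F⁻¹) * F⁻¹

/-- `M` is a matrix of generators of the algebra `M(R̂,F̂)`:
`R̂₁ M_{\overline{1}} M_{\overline{2}} = M_{\overline{1}} M_{\overline{2}} (R̂^{FF})₁`
on `V ⊗ V`. -/
def IsGenerators {K : Type*} [Field K] {A : Type*} [Ring A] [Algebra K A] {N : ℕ}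
    (R F : M2 N K) (M : Matrix (Fin N) (Fin N) A) : Prop :=
  site 2 0 (R.map (algebraMap K A)) *
      MbarSeg 2 (F.map (algebraMap K A)) ((F⁻¹).map (algebraMap K A)) M 0 2 =
    MbarSeg 2 (F.map (algebraMap K A)) ((F⁻¹).map (algebraMap K A)) M 0 2 *
      site 2 0 ((RFF R F).map (algebraMap K A))

/-- Evaluation of a noncommutative polynomial `Y` in `v` variables, substituting
for the variable `x_j` the operator `R̂` placed at the (0-based) sites
`p+j, p+j+1` of `V^{⊗m}`.  For `p = 0` this is the paper's
`Y^{(v+1)} = Y^{(v+1)}(R̂₁,…,R̂_v)`, and a general `p` gives `Y^{(p+1,v+1)}`. -/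
def evalY {K : Type*} [Field K] {A : Type*} [Ring A] [Algebra K A] {N m v : ℕ}
    (R : M2 N A) (p : ℕ) (Y : FreeAlgebra K (Fin v)) : Op N A m :=
  FreeAlgebra.lift K (fun j : Fin v => site m (p + (j : ℕ)) R) Y

/-- `Ustack m R k l = R̂_{l → l+k-1} ⋯ R̂_{2 → k+1} R̂_{1 → k}` (1-based labels):
the product of `l` descending chains of length `k`. -/
def Ustack {A : Type*} [Ring A] {N : ℕ} (m : ℕ) (R : M2 N A) (k : ℕ) :
    ℕ → Op N A m
  | 0 => 1
  | l + 1 => chain m R l k * Ustack m R k l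

/-- The `q`-number `n_q = (qⁿ − q⁻ⁿ)/(q − q⁻¹)`. -/
def qInt {K : Type*} [Field K] (q : K) (n : ℕ) : K :=
  (q ^ n - q⁻¹ ^ n) / (q - q⁻¹)

/-- `R̂` is a Hecke R-matrix for the parameter `q`:  it is invertible, satisfies
the Yang–Baxter equation and the Hecke condition `R̂² = 1 + (q − q⁻¹)R̂`. -/
def IsHecke {K : Type*} [Field K] {N : ℕ} (q : K) (R : M2 N K) : Prop :=
  IsUnit R ∧ YB R ∧ R * R = 1 + (q - q⁻¹) • R

/-- The `q`-antisymmetrizer `A^{(k)}` built from `R̂`, placed at the (0-based)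
tensor factors `p, p+1, …, p+k-1` of `V^{⊗m}`. -/
def qasym {K : Type*} [Field K] {N : ℕ} (q : K) (R : M2 N K) (m p : ℕ) :
    ℕ → Op N K m
  | 0 => 1
  | 1 => 1
  | k + 2 =>
      (qInt q (k + 2))⁻¹ •
        (qasym q R m p (k + 1) *
          (q ^ (k + 1) • (1 : Op N K m) - qInt q (k + 1) • site m (p + k) R) *
          qasym q R m p (k + 1))

/-- The `q`-symmetrizer `S^{(k)}` built from `R̂`, placed at the (0-based)
tensor factors `p, p+1, …, p+k-1` of `V^{⊗m}`. -/
def qsym {K : Type*} [Field K] {N : ℕ} (q : K) (R : M2 N K) (m p : ℕ) :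
    ℕ → Op N K m
  | 0 => 1
  | 1 => 1
  | k + 2 =>
      (qInt q (k + 2))⁻¹ •
        (qsym q R m p (k + 1) *
          (q⁻¹ ^ (k + 1) • (1 : Op N K m) + qInt q (k + 1) • site m (p + k) R) *
          qsym q R m p (k + 1))

/-- The elementary symmetric function
`σ_k(M) = Tr_F(1,…,k)(A^{(k)} M_{\overline{1}}⋯M_{\overline{k}})` (with `σ_0 = 1`). -/
def sigmaF {K : Type*} [Field K] {A : Type*} [Ring A] [Algebra K A] {N : ℕ}
    (q : K) (R F Ψ : M2 N K) (M : Matrix (Fin N) (Fin N) A) (k : ℕ) : A :=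
  qtrAll (Dmat Ψ)
    ((qasym q R k 0 k).map (algebraMap K A) *
      MbarSeg k (F.map (algebraMap K A)) ((F⁻¹).map (algebraMap K A)) M 0 k)

/-- The complete symmetric function
`τ_k(M) = Tr_F(1,…,k)(S^{(k)} M_{\overline{1}}⋯M_{\overline{k}})` (with `τ_0 = 1`). -/
def tauF {K : Type*} [Field K] {A : Type*} [Ring A] [Algebra K A] {N : ℕ}
    (q : K) (R F Ψ : M2 N K) (M : Matrix (Fin N) (Fin N) A) (k : ℕ) : A :=
  qtrAll (Dmat Ψ)
    ((qsym q R k 0 k).map (algebraMap K A) *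
      MbarSeg k (F.map (algebraMap K A)) ((F⁻¹).map (algebraMap K A)) M 0 k)

/-- The power sums `s_k(M) = Tr_F(1,…,k)(R̂_{1→k−1} M_{\overline{1}}⋯M_{\overline{k}})`,
with `s_0 = 1`. -/
def sF {K : Type*} [Field K] {A : Type*} [Ring A] [Algebra K A] {N : ℕ}
    (R F Ψ : M2 N K) (M : Matrix (Fin N) (Fin N) A) : ℕ → A
  | 0 => 1
  | j + 1 =>
      qtrAll (Dmat Ψ)
        (chain (j + 1) (R.map (algebraMap K A)) 0 j *
          MbarSeg (j + 1) (F.map (algebraMap K A)) ((F⁻¹).map (algebraMap K A)) M 0 (j + 1))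

/-- The `(j+1)`-st quantum power of `M`,
`M^{\overline{j+1}} = Tr_F(2,…,j+1)(R̂_{1→j} M_{\overline{1}}⋯M_{\overline{j+1}})`,
as a one-site operator (so `MpowF R F Ψ M 0 = M₁ = M`). -/
def MpowF {K : Type*} [Field K] {A : Type*} [Ring A] [Algebra K A] {N : ℕ}
    (R F Ψ : M2 N K) (M : Matrix (Fin N) (Fin N) A) (j : ℕ) : Op N A 1 :=
  qtrs (Dmat Ψ) 1 j
    (chain (1 + j) (R.map (algebraMap K A)) 0 j *
      MbarSeg (1 + j) (F.map (algebraMap K A)) ((F⁻¹).map (algebraMap K A)) M 0 (j + 1))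

/-- The `(j+1)`-st wedge power of `M`,
`M^{∧(j+1)} = Tr_F(2,…,j+1)(A^{(j+1)} M_{\overline{1}}⋯M_{\overline{j+1}})`. -/
def MwedgeF {K : Type*} [Field K] {A : Type*} [Ring A] [Algebra K A] {N : ℕ}
    (q : K) (R F Ψ : M2 N K) (M : Matrix (Fin N) (Fin N) A) (j : ℕ) : Op N A 1 :=
  qtrs (Dmat Ψ) 1 j
    ((qasym q R (1 + j) 0 (j + 1)).map (algebraMap K A) *
      MbarSeg (1 + j) (F.map (algebraMap K A)) ((F⁻¹).map (algebraMap K A)) M 0 (j + 1))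

/-- The `(j+1)`-st symmetric power of `M`,
`M^{S(j+1)} = Tr_F(2,…,j+1)(S^{(j+1)} M_{\overline{1}}⋯M_{\overline{j+1}})`. -/
def MsymF {K : Type*} [Field K] {A : Type*} [Ring A] [Algebra K A] {N : ℕ}
    (q : K) (R F Ψ : M2 N K) (M : Matrix (Fin N) (Fin N) A) (j : ℕ) : Op N A 1 :=
  qtrs (Dmat Ψ) 1 j
    ((qsym q R (1 + j) 0 (j + 1)).map (algebraMap K A) *
      MbarSeg (1 + j) (F.map (algebraMap K A)) ((F⁻¹).map (algebraMap K A)) M 0 (j + 1))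

/-- `M^{\overline{0}} := q^{-n} n_q Tr_{(2,…,n)}(A^{(n)}) D^{-1}`, with `n = n0 + 1`
(an ordinary, non-quantum, trace over the factors `2,…,n`). -/
def MzeroF {K : Type*} [Field K] {N : ℕ} (q : K) (R Ψ : M2 N K) (n0 : ℕ) :
    Op N K 1 :=
  (q⁻¹ ^ (n0 + 1) * qInt q (n0 + 1)) •
    (ptrs 1 n0 (qasym q R (1 + n0) 0 (n0 + 1)) * site1 1 0 ((Dmat Ψ)⁻¹))

/-- The generators of the characteristic subalgebra: all elements
`α(Y^{(k)}) = Tr_F(1,…,k)(Y^{(k)} M_{\overline{1}}⋯M_{\overline{k}})`, `k ≥ 1`. -/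
def charSet {K : Type*} [Field K] {A : Type*} [Ring A] [Algebra K A] {N : ℕ}
    (R F Ψ : M2 N K) (M : Matrix (Fin N) (Fin N) A) : Set A :=
  { x : A | ∃ (v : ℕ) (Y : FreeAlgebra K (Fin v)),
      x = qtrAll (Dmat Ψ)
        (evalY (R.map (algebraMap K A)) 0 Y *
          MbarSeg (v + 1) (F.map (algebraMap K A)) ((F⁻¹).map (algebraMap K A)) M 0 (v + 1)) }

end

section Placement

open scoped Kronecker

/-- Splitting a multi-index into its restriction along an injection `f` and its
restriction to the complement of the range of `f`. -/
noncomputable def splitIndex {l m : ℕ} (N : ℕ) (f : Fin l → Fin m) (hf : Function.Injective f) :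
    (Fin m → Fin N) ≃ (Fin l → Fin N) × ({j // ¬ j ∈ Set.range f} → Fin N) :=
  open Classical in
  (Equiv.piEquivPiSubtypeProd (· ∈ Set.range f) fun _ => Fin N).trans
    (Equiv.prodCongr (Equiv.arrowCongr (Equiv.ofInjective f hf).symm (Equiv.refl _))
      (Equiv.refl _))

/-- The operator on `V^{⊗m}` acting as `X` on the tensor factors in the range of `f` and
as the identity on the others. -/
noncomputable def place {K : Type*} [Field K] {N l m : ℕ} (f : Fin l → Fin m)
    (hf : Function.Injective f) (X : Op N K l) : Op N K m :=
  (X ⊗ₖ (1 : Matrix ({j // ¬ j ∈ Set.range f} → Fin N) _ K)).submatrix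
    (splitIndex N f hf) (splitIndex N f hf)

variable {K : Type*} [Field K] {N l m : ℕ} (f : Fin l → Fin m) (hf : Function.Injective f)

theorem place_apply (X : Op N K l) (a b : Fin m → Fin N) :
    place f hf X a b =
      X (a ∘ f) (b ∘ f) * if ∀ j, j ∉ Set.range f → a j = b j then 1 else 0 := by
  have h1 (c : Fin m → Fin N) : (splitIndex N f hf c).1 = c ∘ f := rfl
  have h2 : ((splitIndex N f hf a).2 = (splitIndex N f hf b).2) ↔
      ∀ j, j ∉ Set.range f → a j = b j := by
    rw [funext_iff, Subtype.forall]
    rfl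
  simp only [place, Matrix.submatrix_apply, Matrix.kroneckerMap_apply, Matrix.one_apply, h1, h2]

theorem place_mul (X Y : Op N K l) : place f hf (X * Y) = place f hf X * place f hf Y := by
  rw [place, place, place, Matrix.submatrix_mul_equiv, ← Matrix.mul_kronecker_mul, one_mul]

theorem place_one : place f hf (1 : Op N K l) = 1 := by
  simp [place]

theorem place_add (X Y : Op N K l) : place f hf (X + Y) = place f hf X + place f hf Y := by
  ext a b
  simp only [place_apply, Matrix.add_apply, add_mul]

theorem place_smul (c : K) (X : Op N K l) : place f hf (c • X) = c • place f hf X := by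
  ext a b
  simp only [place_apply, Matrix.smul_apply, smul_eq_mul, mul_assoc]

/-- The inclusion of the consecutive positions `i, …, i + l - 1`. -/
def shift {l m : ℕ} (i : ℕ) (h : i + l ≤ m) (j : Fin l) : Fin m := ⟨i + j, by omega⟩

theorem shift_injective {l m : ℕ} (i : ℕ) (h : i + l ≤ m) :
    Function.Injective (shift i h) := by
  intro x y hxy
  simpa [shift, Fin.ext_iff] using hxy

theorem mem_range_shift {l m : ℕ} (i : ℕ) (h : i + l ≤ m) (j : Fin m) :
    j ∈ Set.range (shift i h) ↔ i ≤ j ∧ j < i + l := by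
  constructor
  · rintro ⟨t, rfl⟩
    simp only [shift]
    omega
  · rintro ⟨h1, h2⟩
    exact ⟨⟨j - i, by omega⟩, Fin.ext (by simp only [shift]; omega)⟩

theorem site_eq_place (X : M2 N K) (i : ℕ) (h : i + 2 ≤ m) :
    site m i X = place (shift i h) (shift_injective i h)
      (X.submatrix (finTwoArrowEquiv (Fin N)) (finTwoArrowEquiv (Fin N))) := by
  ext a b
  have hiff : (∀ j : Fin m, (j : ℕ) ≠ i → (j : ℕ) ≠ i + 1 → a j = b j) ↔
      ∀ j, j ∉ Set.range (shift i h) → a j = b j := by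
    refine forall_congr' fun j => ?_
    rw [mem_range_shift]
    exact ⟨fun H hj => H (by omega) (by omega), fun H h1 h2 => H (by omega)⟩
  simp only [site, dif_pos (show i + 1 < m by omega), place_apply, hiff]
  rfl

theorem place_site (X : M2 N K) (i j : ℕ) (h : i + l ≤ m) (hj : j + 1 < l) :
    place (shift i h) (shift_injective i h) (site l j X) = site m (i + j) X := by
  ext a b
  rw [place_apply]
  simp only [site, dif_pos hj, dif_pos (show i + j + 1 < m by omega), mul_assoc]
  congr 1
  rw [ite_zero_mul_ite_zero, mul_one]
  refine if_congr ?_ rfl rfl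
  simp only [mem_range_shift]
  constructor
  · rintro ⟨h1, h2⟩ t ht1 ht2
    by_cases ht : i ≤ t ∧ (t : ℕ) < i + l
    · have := h1 ⟨t - i, by omega⟩ (by simp only; omega) (by simp only; omega)
      have e : shift i h ⟨t - i, by omega⟩ = t := Fin.ext (by simp only [shift]; omega)
      simpa only [Function.comp_apply, e] using this
    · exact h2 t ht
  · intro H
    refine ⟨fun t ht1 ht2 => H _ ?_ ?_, fun t ht => H t ?_ ?_⟩ <;>
      (try simp only [shift]) <;> omega

theorem site_of_le (X : M2 N K) (i : ℕ) (h : m ≤ i + 1) : site m i X = 1 := by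
  ext a b
  simp only [site, dif_neg (show ¬ i + 1 < m by omega), Matrix.one_apply]

theorem site_hecke {c : K} {X : M2 N K} (hX : X * X = 1 + c • X) (i : ℕ) (h : i + 2 ≤ m) :
    site m i X * site m i X = 1 + c • site m i X := by
  rw [site_eq_place X i h, ← place_mul, Matrix.submatrix_mul_equiv, hX, Matrix.submatrix_add,
    Pi.add_apply, Pi.add_apply, Matrix.submatrix_smul, Pi.smul_apply, Pi.smul_apply,
    Matrix.submatrix_one_equiv, place_add, place_one, place_smul]

theorem site_braid {X : M2 N K} (hX : YB X) (i : ℕ) (h : i + 3 ≤ m) :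
    site m i X * site m (i + 1) X * site m i X =
      site m (i + 1) X * site m i X * site m (i + 1) X := by
  have h0 := place_site X i 0 h (by omega)
  have h1 := place_site X i 1 h (by omega)
  rw [add_zero] at h0
  rw [← h0, ← h1, ← place_mul, ← place_mul, hX, place_mul, place_mul]

theorem site_mul_site_apply (X Y : M2 N K) (i j : ℕ) (hij : i + 1 < j ∨ j + 1 < i)
    (hi : i + 1 < m) (hj : j + 1 < m) (a b : Fin m → Fin N) :
    (site m i X * site m j Y) a b =
      X (a ⟨i, by omega⟩, a ⟨i + 1, hi⟩) (b ⟨i, by omega⟩, b ⟨i + 1, hi⟩) *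
        Y (a ⟨j, by omega⟩, a ⟨j + 1, hj⟩) (b ⟨j, by omega⟩, b ⟨j + 1, hj⟩) *
        if ∀ t : Fin m, (t : ℕ) ≠ i → (t : ℕ) ≠ i + 1 → (t : ℕ) ≠ j → (t : ℕ) ≠ j + 1 →
          a t = b t then 1 else 0 := by
  rw [Matrix.mul_apply,
    Finset.sum_eq_single fun t : Fin m => if (t : ℕ) = i ∨ (t : ℕ) = i + 1 then b t else a t]
  · have e1 : ¬ (j = i ∨ j = i + 1) := by omega
    have e2 : ¬ (j + 1 = i ∨ j + 1 = i + 1) := by omega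
    simp only [site, dif_pos hi, dif_pos hj, if_neg e1, if_neg e2, true_or, or_true, if_true]
    rw [if_pos (fun t h1 h2 => by rw [if_neg (by omega)]), mul_one, mul_assoc]
    congr 2
    refine if_congr (forall_congr' fun t => ?_) rfl rfl
    by_cases ht : (t : ℕ) = i ∨ (t : ℕ) = i + 1
    · simp only [if_pos ht]
      tauto
    · simp only [if_neg ht]
      tauto
  · intro c _ hc
    by_contra hne
    refine hc (funext fun t => ?_)
    simp only [site, dif_pos hi, dif_pos hj] at hne
    have h1 := (ite_ne_right_iff.1 (right_ne_zero_of_mul (left_ne_zero_of_mul hne))).1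
    have h2 := (ite_ne_right_iff.1 (right_ne_zero_of_mul (right_ne_zero_of_mul hne))).1
    split_ifs with ht
    · exact h2 t (by omega) (by omega)
    · exact (h1 t (by omega) (by omega)).symm
  · simp

theorem site_commute (X Y : M2 N K) {i j : ℕ} (hij : i + 1 < j) :
    Commute (site m i X) (site m j Y) := by
  by_cases hj : j + 1 < m
  · ext a b
    rw [site_mul_site_apply X Y i j (.inl hij) (by omega) hj,
      site_mul_site_apply Y X j i (.inr hij) hj (by omega)]
    rw [mul_comm (X _ _)]
    congr 1
    exact if_congr (forall_congr' fun t => by tauto) rfl rfl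
  · rw [site_of_le Y j (by omega)]
    exact Commute.one_right _

end Placement

theorem qInt_succ {K : Type*} [Field K] {q : K} (hq0 : q ≠ 0) (hq1 : q ^ 2 ≠ 1) (n : ℕ) :
    qInt q (n + 1) = q ^ n + q⁻¹ * qInt q n := by
  have h : q - q⁻¹ ≠ 0 := fun h => hq1 (by
    rw [sub_eq_zero] at h
    rw [sq]
    nth_rewrite 1 [h]
    exact inv_mul_cancel₀ hq0)
  rw [qInt, qInt, div_eq_iff h, add_mul, mul_assoc, div_mul_cancel₀ _ h, pow_succ, pow_succ]
  ring

/-- The inductive step for `A^{(n+1)} R̂_n = -q⁻¹ A^{(n+1)}`. -/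
theorem antisymmetrizer_step {K B : Type*} [Field K] [Ring B] [Algebra K B]
    {q s a b : K} {A P g h : B} (hq : q ≠ 0) (hs : a = s + q⁻¹ * b)
    (hA : A = a⁻¹ • (P * (s • (1 : B) - b • h) * P)) (hAP : A * P = A) (hPg : Commute P g)
    (hAh : A * h = -q⁻¹ • A) (hbraid : h * g * h = g * h * g)
    (hg : g * g = 1 + (q - q⁻¹) • g) :
    A * ((q * s) • (1 : B) - a • g) * A * g =
      -q⁻¹ • (A * ((q * s) • (1 : B) - a • g) * A) := by
  have hAghg : A * (g * (h * g)) = -q⁻¹ • (A * (g * h)) := by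
    rw [← mul_assoc g, ← hbraid, ← mul_assoc, ← mul_assoc, hAh]
    simp only [smul_mul_assoc, mul_assoc]
  have key : A * ((q * s) • (1 : B) - a • g) * (s • (1 : B) - b • h) * g =
      -q⁻¹ • (A * ((q * s) • (1 : B) - a • g) * (s • (1 : B) - b • h)) := by
    have e : A * ((q * s) • (1 : B) - a • g) * (s • (1 : B) - b • h) =
        (q * s * a) • A - (a * s) • (A * g) + (a * b) • (A * (g * h)) := by
      simp only [mul_sub, sub_mul, mul_smul_comm, smul_mul_assoc, mul_one, hAh, mul_assoc]
      rw [hs]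
      module
    rw [e]
    simp only [add_mul, sub_mul, smul_mul_assoc, mul_assoc, hAghg, hg, mul_add, mul_smul_comm,
      mul_one]
    match_scalars <;> field_simp
    all_goals ring
  have hC : A * ((q * s) • (1 : B) - a • g) * P = A * ((q * s) • (1 : B) - a • g) := by
    have : Commute P ((q * s) • (1 : B) - a • g) :=
      ((Commute.one_right P).smul_right _).sub_right (hPg.smul_right _)
    rw [mul_assoc, ← this.eq, ← mul_assoc, hAP]
  have e : A * ((q * s) • (1 : B) - a • g) * A =
      a⁻¹ • (A * ((q * s) • (1 : B) - a • g) * (s • (1 : B) - b • h) * P) := by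
    generalize A * ((q * s) • (1 : B) - a • g) = C at hC ⊢
    rw [hA, mul_smul_comm, ← mul_assoc, ← mul_assoc, hC]
  rw [e, smul_mul_assoc, mul_assoc _ P, hPg.eq, ← mul_assoc, key, smul_mul_assoc, smul_comm]

section Projectors

variable {K : Type*} [Field K] {N : ℕ} {q : K} {R : M2 N K}

theorem qasym_commute_site (q : K) (R : M2 N K) (m n j : ℕ) (h : n ≤ j) :
    Commute (qasym q R m 0 n) (site m j R) := by
  match n with
  | 0 => exact Commute.one_left _
  | 1 => exact Commute.one_left _
  | n + 2 =>
    have ih := qasym_commute_site q R m (n + 1) j (by omega)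
    have hs := site_commute (m := m) R R (show 0 + n + 1 < j by omega)
    rw [qasym]
    exact ((ih.mul_left (((Commute.one_left _).smul_left _).sub_left
      (hs.smul_left _))).mul_left ih).smul_left _

theorem qasym_succ (q : K) (R : M2 N K) (m n : ℕ) :
    qasym q R m 0 (n + 2) = (qInt q (n + 2))⁻¹ • (qasym q R m 0 (n + 1) *
      (q ^ (n + 1) • (1 : Op N K m) - qInt q (n + 1) • site m n R) *
      qasym q R m 0 (n + 1)) := by
  rw [qasym, zero_add]

theorem qasym_absorbs (hq0 : q ≠ 0) (hq1 : q ^ 2 ≠ 1) (hYB : YB R)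
    (hR : R * R = 1 + (q - q⁻¹) • R) (m n : ℕ) (hn : n + 1 ≤ m)
    (hqn : ∀ j : ℕ, 1 ≤ j → j ≤ n + 1 → qInt q j ≠ 0) :
    (∀ i < n, qasym q R m 0 (n + 1) * site m i R = -q⁻¹ • qasym q R m 0 (n + 1)) ∧
      qasym q R m 0 (n + 1) * qasym q R m 0 n = qasym q R m 0 (n + 1) ∧
      qasym q R m 0 (n + 1) * qasym q R m 0 (n + 1) = qasym q R m 0 (n + 1) := by
  induction n with
  | zero => exact ⟨by simp, one_mul _, one_mul _⟩
  | succ n ih =>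
    obtain ⟨ihabs, ihprev, ihsq⟩ := ih (by omega) fun j h1 h2 => hqn j h1 (by omega)
    have hlast : qasym q R m 0 (n + 1) *
          (q ^ (n + 1) • (1 : Op N K m) - qInt q (n + 1) • site m n R) *
          qasym q R m 0 (n + 1) * site m n R =
        -q⁻¹ • (qasym q R m 0 (n + 1) *
          (q ^ (n + 1) • (1 : Op N K m) - qInt q (n + 1) • site m n R) *
          qasym q R m 0 (n + 1)) := by
      have hg := site_hecke hR n (show n + 2 ≤ m by omega)
      match n with
      | 0 =>
        have h1 : qInt q (0 + 1) = 1 := by rw [qInt_succ hq0 hq1]; simp [qInt]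
        simp only [qasym, one_mul, mul_one, h1, sub_mul, smul_mul_assoc, hg]
        match_scalars <;> field_simp <;> ring
      | n + 1 =>
        rw [pow_succ' q (n + 1)]
        exact antisymmetrizer_step hq0 (qInt_succ hq0 hq1 (n + 1)) (qasym_succ q R m n) ihprev
          (qasym_commute_site q R m (n + 1) (n + 1) le_rfl) (ihabs n (by omega))
          (site_braid hYB n (by omega)) hg
    have hsite : qasym q R m 0 (n + 2) * site m n R = -q⁻¹ • qasym q R m 0 (n + 2) := by
      rw [qasym_succ, smul_mul_assoc, hlast, smul_comm]
    have hprev : qasym q R m 0 (n + 2) * qasym q R m 0 (n + 1) = qasym q R m 0 (n + 2) := by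
      rw [qasym_succ, smul_mul_assoc, mul_assoc _ (qasym q R m 0 (n + 1)), ihsq]
    refine ⟨fun i hi => ?_, hprev, ?_⟩
    · rcases Nat.lt_succ_iff_lt_or_eq.1 hi with hi | rfl
      · rw [qasym_succ, smul_mul_assoc, mul_assoc _ (qasym q R m 0 (n + 1)), ihabs i hi,
          mul_smul_comm, smul_comm]
      · exact hsite
    · have hq := hqn (n + 2) (by omega) le_rfl
      have hX : qasym q R m 0 (n + 2) *
          (q ^ (n + 1) • (1 : Op N K m) - qInt q (n + 1) • site m n R) =
          qInt q (n + 2) • qasym q R m 0 (n + 2) := by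
        rw [mul_sub, mul_smul_comm, mul_smul_comm, hsite, mul_one, qInt_succ hq0 hq1 (n + 1)]
        module
      nth_rewrite 2 [qasym_succ]
      rw [mul_smul_comm, ← mul_assoc, ← mul_assoc, hprev, hX, smul_mul_assoc, hprev,
        inv_smul_smul₀ hq]

theorem qasym_mul_self (hq0 : q ≠ 0) (hq1 : q ^ 2 ≠ 1) (hYB : YB R)
    (hR : R * R = 1 + (q - q⁻¹) • R) (k : ℕ)
    (hqk : ∀ n : ℕ, 1 ≤ n → n ≤ k → qInt q n ≠ 0) :
    qasym q R k 0 k * qasym q R k 0 k = qasym q R k 0 k := by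
  match k with
  | 0 => exact one_mul _
  | k + 1 => exact (qasym_absorbs hq0 hq1 hYB hR (k + 1) k le_rfl hqk).2.2

theorem qInt_neg_inv (q : K) (n : ℕ) : qInt (-q⁻¹) n = (-1) ^ (n + 1) * qInt q n := by
  have h : (-q⁻¹)⁻¹ = -q := by rw [inv_neg, inv_inv]
  rw [qInt, qInt, h, neg_pow q⁻¹, neg_pow q, show -q⁻¹ - -q = q - q⁻¹ by ring]
  ring

theorem qsym_eq_qasym (q : K) (R : M2 N K) (m p n : ℕ) :
    qsym q R m p n = qasym (-q⁻¹) R m p n := by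
  match n with
  | 0 => rfl
  | 1 => rfl
  | n + 2 =>
    have e : (-q⁻¹) ^ (n + 1) • (1 : Op N K m) - qInt (-q⁻¹) (n + 1) • site m (p + n) R =
        (-1 : K) ^ (n + 1) •
          (q⁻¹ ^ (n + 1) • (1 : Op N K m) + qInt q (n + 1) • site m (p + n) R) := by
      rw [qInt_neg_inv, neg_pow q⁻¹]
      module
    have hsign : (((-1 : K) ^ (n + 2 + 1) * qInt q (n + 2))⁻¹ * (-1) ^ (n + 1)) =
        (qInt q (n + 2))⁻¹ := by
      have : (-1 : K) ^ (n + 2 + 1) = (-1) ^ (n + 1) := by ring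
      rw [this, mul_inv, mul_right_comm, inv_mul_cancel₀ (pow_ne_zero _ (by simp)), one_mul]
    rw [qsym, qasym, e, qsym_eq_qasym q R m p (n + 1), mul_smul_comm, smul_mul_assoc, smul_smul,
      qInt_neg_inv, hsign]

end Projectors

/-- For a Hecke R-matrix `R̂` with `m_q ≠ 0` for `1 ≤ m ≤ k`,
the `q`-antisymmetrizer `A^{(k)}` and the `q`-symmetrizer `S^{(k)}` are
projectors on `V^{⊗k}`. -/
theorem antisymmetrizer_symmetrizer_projectors {K : Type} [Field K] {N : ℕ}
    (q : K) (R : M2 N K) (hq0 : q ≠ 0) (hq1 : q ^ 2 ≠ 1) (hH : IsHecke q R)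
    (k : ℕ) (hqk : ∀ n : ℕ, 1 ≤ n → n ≤ k → qInt q n ≠ 0) :
    qasym q R k 0 k * qasym q R k 0 k = qasym q R k 0 k ∧
    qsym q R k 0 k * qsym q R k 0 k = qsym q R k 0 k := by
  obtain ⟨-, hYB, hR⟩ := hH
  refine ⟨qasym_mul_self hq0 hq1 hYB hR k hqk, ?_⟩
  rw [qsym_eq_qasym]
  refine qasym_mul_self (neg_ne_zero.2 (inv_ne_zero hq0)) ?_ hYB ?_ k fun n h1 h2 => ?_
  · rwa [neg_sq, inv_pow, ne_eq, inv_eq_one]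
  · rw [hR, inv_neg, inv_inv, neg_sub_neg]
  · rw [qInt_neg_inv]
    exact mul_ne_zero (pow_ne_zero _ (by simp)) (hqk n h1 h2)

end CHN
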